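/- arXiv:2406.18033 — 8 statements merged into one kernel-verified Lean document; each statement's English description precedes it below -/
import Mathlib

section
/- The soft Bellman operator B is a γ-contraction in the sup norm: for all Q, Q' : S → A → ℝ, sup_{(s,a)} |(B Q)(s,a) − (B Q')(s,a)| ≤ γ · sup_{(s,a)} |Q(s,a) − Q'(s,a)|. -/
open Real Filter

/-- The soft (entropy-regularized) Bellman operator for a finite MDP with transition
kernel `p`, reward `r`, discount `γ`, inverse temperature `β` and prior policy `π0`. -/
noncomputable def softBellman {S A : Type*} [Fintype S] [Fintype A]
    (p : S → A → PMF S) (r : S → A → ℝ) (γ β : ℝ) (π0 : S → PMF A)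
    (Q : S → A → ℝ) : S → A → ℝ :=
  fun s a => r s a + (γ / β) * ∑ s' : S, (p s a s').toReal *
      Real.log (∑ a' : A, (π0 s' a').toReal * Real.exp (β * Q s' a'))

theorem pmf_sum_toReal_aux {S : Type*} [Fintype S] (q : PMF S) : ∑ s, (q s).toReal = 1 := by
  rw [← ENNReal.toReal_sum (fun a _ => q.apply_ne_top a), ← tsum_fintype (L := .unconditional S),
    q.tsum_coe]
  simp

theorem log_sum_le_aux {A : Type*} [Fintype A] [Nonempty A] (w : A → ℝ) (hw : ∀ a, 0 < w a)
    (β M : ℝ) (hβ : 0 < β) (f g : A → ℝ) (h : ∀ a, f a ≤ g a + M) :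
    Real.log (∑ a, w a * Real.exp (β * f a)) ≤
      Real.log (∑ a, w a * Real.exp (β * g a)) + β * M := by
  have pos : ∀ f : A → ℝ, 0 < ∑ a, w a * Real.exp (β * f a) := fun f =>
    Finset.sum_pos (fun a _ => mul_pos (hw a) (Real.exp_pos _)) Finset.univ_nonempty
  rw [← Real.log_exp (β * M), ← Real.log_mul (pos g).ne' (Real.exp_pos _).ne']
  apply Real.log_le_log (pos f)
  rw [Finset.sum_mul]
  apply Finset.sum_le_sum
  intro a _
  rw [mul_assoc, ← Real.exp_add]
  apply mul_le_mul_of_nonneg_left _ (hw a).le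
  apply Real.exp_le_exp.2
  nlinarith [h a]

/-- The soft Bellman operator is a `γ`-contraction in the sup norm. -/
theorem softBellman_contraction {S A : Type*} [Fintype S] [Fintype A] [Nonempty S] [Nonempty A]
    (p : S → A → PMF S) (r : S → A → ℝ) (γ β : ℝ) (π0 : S → PMF A)
    (hγ0 : 0 ≤ γ) (hγ1 : γ < 1) (hβ : 0 < β)
    (hπ0 : ∀ s a, 0 < π0 s a)
    (Q Q' : S → A → ℝ) :
    (⨆ x : S × A, |softBellman p r γ β π0 Q x.1 x.2 - softBellman p r γ β π0 Q' x.1 x.2|) ≤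
      γ * ⨆ x : S × A, |Q x.1 x.2 - Q' x.1 x.2| := by
  have hM : ∀ s a, |Q s a - Q' s a| ≤ ⨆ x : S × A, |Q x.1 x.2 - Q' x.1 x.2| := fun s a =>
    le_ciSup (f := fun x : S × A => |Q x.1 x.2 - Q' x.1 x.2|) (Set.finite_range _).bddAbove (s, a)
  generalize (⨆ x : S × A, |Q x.1 x.2 - Q' x.1 x.2|) = M at hM ⊢
  have hw : ∀ s a, 0 < (π0 s a).toReal := fun s a =>
    ENNReal.toReal_pos (hπ0 s a).ne' ((π0 s).apply_ne_top a)
  apply ciSup_le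
  rintro ⟨s, a⟩
  have key : ∀ P P' : S → A → ℝ, (∀ s a, P s a ≤ P' s a + M) →
      softBellman p r γ β π0 P s a ≤ softBellman p r γ β π0 P' s a + γ * M := by
    intro P P' h
    have h1 : ∑ s' : S, (p s a s').toReal *
          Real.log (∑ a' : A, (π0 s' a').toReal * Real.exp (β * P s' a')) ≤
        ∑ s' : S, (p s a s').toReal *
          Real.log (∑ a' : A, (π0 s' a').toReal * Real.exp (β * P' s' a')) + β * M := by
      calc _ ≤ ∑ s' : S, (p s a s').toReal *
          (Real.log (∑ a' : A, (π0 s' a').toReal * Real.exp (β * P' s' a')) + β * M) :=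
            Finset.sum_le_sum fun s' _ => mul_le_mul_of_nonneg_left
              (log_sum_le_aux _ (hw s') β M hβ _ _ (h s')) ENNReal.toReal_nonneg
        _ = _ := by
          simp only [mul_add, Finset.sum_add_distrib]
          rw [← Finset.sum_mul, pmf_sum_toReal_aux, one_mul]
    have h2 := mul_le_mul_of_nonneg_left h1 (div_nonneg hγ0 hβ.le)
    have h3 : γ / β * (β * M) = γ * M := by field_simp
    rw [mul_add, h3] at h2
    unfold softBellman
    linarith
  have k1 := key Q Q' fun s a => by linarith [(abs_le.1 (hM s a)).2]
  have k2 := key Q' Q fun s a => by linarith [(abs_le.1 (hM s a)).1]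
  exact abs_le.2 ⟨by simp only; linarith, by simp only; linarith⟩
end

section
/- The soft Bellman operator B has a unique fixed point Q* : S → A → ℝ, and for every function Q : S → A → ℝ the iterates B^n Q converge uniformly to Q* as n → ∞, i.e. sup_{(s,a)} |(B^n Q)(s,a) − Q*(s,a)| → 0. -/
open Real Filter

theorem softBellman_log_le {A : Type*} [Fintype A] [Nonempty A] (β d : ℝ) (hβ : 0 < β)
    (q : PMF A) (hq : ∀ a, 0 < q a) (f g : A → ℝ) (h : ∀ a, f a ≤ g a + d) :
    Real.log (∑ a, (q a).toReal * Real.exp (β * f a)) ≤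
      Real.log (∑ a, (q a).toReal * Real.exp (β * g a)) + β * d := by
  have hq' : ∀ a, 0 < (q a).toReal := fun a =>
    ENNReal.toReal_pos (hq a).ne' (q.apply_ne_top a)
  have hpos : ∀ f : A → ℝ, 0 < ∑ a, (q a).toReal * Real.exp (β * f a) := fun f =>
    Finset.sum_pos (fun a _ => mul_pos (hq' a) (Real.exp_pos _)) Finset.univ_nonempty
  rw [← Real.log_exp (β * d), ← Real.log_mul (hpos g).ne' (Real.exp_pos _).ne']
  apply Real.log_le_log (hpos f)
  rw [Finset.sum_mul]
  apply Finset.sum_le_sum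
  intro a _
  rw [mul_assoc, ← Real.exp_add, ← mul_add]
  have := h a
  have := hq' a
  gcongr

theorem softBellman_le {S A : Type*} [Fintype S] [Fintype A] [Nonempty A]
    (p : S → A → PMF S) (r : S → A → ℝ) (γ β : ℝ) (π0 : S → PMF A)
    (hγ0 : 0 ≤ γ) (hβ : 0 < β) (hπ0 : ∀ s a, 0 < π0 s a)
    (P Q : S → A → ℝ) (d : ℝ) (h : ∀ s a, P s a ≤ Q s a + d) (s : S) (a : A) :
    softBellman p r γ β π0 P s a ≤ softBellman p r γ β π0 Q s a + γ * d := by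
  have hsum : ∑ s', (p s a s').toReal = 1 := by
    rw [← ENNReal.toReal_sum (fun s' _ => (p s a).apply_ne_top s'), ← tsum_fintype (L := .unconditional S),
      (p s a).tsum_coe, ENNReal.toReal_one]
  have key : ∑ s' : S, (p s a s').toReal *
      Real.log (∑ a' : A, (π0 s' a').toReal * Real.exp (β * P s' a')) ≤
      (∑ s' : S, (p s a s').toReal *
      Real.log (∑ a' : A, (π0 s' a').toReal * Real.exp (β * Q s' a'))) + β * d := by
    calc _ ≤ ∑ s' : S, (p s a s').toReal *
          (Real.log (∑ a' : A, (π0 s' a').toReal * Real.exp (β * Q s' a')) + β * d) :=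
          Finset.sum_le_sum fun s' _ => mul_le_mul_of_nonneg_left
            (softBellman_log_le β d hβ (π0 s') (hπ0 s') _ _ (h s')) ENNReal.toReal_nonneg
      _ = _ := by
          simp only [mul_add, Finset.sum_add_distrib]
          rw [← Finset.sum_mul, hsum, one_mul]
  have h2 := mul_le_mul_of_nonneg_left key (div_nonneg hγ0 hβ.le)
  have h3 : γ / β * (β * d) = γ * d := by field_simp
  rw [mul_add, h3] at h2
  unfold softBellman
  linarith

theorem softBellman_contracting {S A : Type*} [Fintype S] [Fintype A] [Nonempty A]
    (p : S → A → PMF S) (r : S → A → ℝ) (γ β : ℝ) (π0 : S → PMF A)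
    (hγ0 : 0 ≤ γ) (hγ1 : γ < 1) (hβ : 0 < β) (hπ0 : ∀ s a, 0 < π0 s a) :
    ContractingWith ⟨γ, hγ0⟩ (softBellman p r γ β π0) := by
  refine ⟨by exact_mod_cast hγ1, LipschitzWith.of_dist_le_mul fun P Q => ?_⟩
  have hd : ∀ s a, |P s a - Q s a| ≤ dist P Q := fun s a =>
    (Real.dist_eq _ _).symm.le.trans ((dist_le_pi_dist (P s) (Q s) a).trans (dist_le_pi_dist P Q s))
  have h0 : 0 ≤ γ * dist P Q := mul_nonneg hγ0 dist_nonneg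
  change _ ≤ γ * dist P Q
  refine (dist_pi_le_iff h0).2 fun s => (dist_pi_le_iff h0).2 fun a => ?_
  rw [Real.dist_eq, abs_le]
  have h1 := softBellman_le p r γ β π0 hγ0 hβ hπ0 P Q (dist P Q)
    (fun s a => by linarith [(abs_le.1 (hd s a)).2]) s a
  have h2 := softBellman_le p r γ β π0 hγ0 hβ hπ0 Q P (dist P Q)
    (fun s a => by linarith [(abs_le.1 (hd s a)).1]) s a
  constructor <;> linarith

/-- The soft Bellman operator has a unique fixed point `Q*`, and for every `Q` the
iterates `B^[n] Q` converge uniformly (in sup norm) to `Q*`. -/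
theorem softBellman_unique_fixedPoint_and_convergence
    {S A : Type*} [Fintype S] [Fintype A] [Nonempty S] [Nonempty A]
    (p : S → A → PMF S) (r : S → A → ℝ) (γ β : ℝ) (π0 : S → PMF A)
    (hγ0 : 0 ≤ γ) (hγ1 : γ < 1) (hβ : 0 < β)
    (hπ0 : ∀ s a, 0 < π0 s a) :
    ∃! Qstar : S → A → ℝ,
      softBellman p r γ β π0 Qstar = Qstar ∧
      ∀ Q : S → A → ℝ,
        Tendsto
          (fun n => ⨆ x : S × A,
            |(softBellman p r γ β π0)^[n] Q x.1 x.2 - Qstar x.1 x.2|)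
          atTop (nhds 0) := by
  have hc := softBellman_contracting p r γ β π0 hγ0 hγ1 hβ hπ0
  refine ⟨hc.fixedPoint, ⟨hc.fixedPoint_isFixedPt, fun Q => ?_⟩, fun Q' h =>
    hc.fixedPoint_unique h.1⟩
  have ht := tendsto_iff_dist_tendsto_zero.1 (hc.tendsto_iterate_fixedPoint Q)
  refine squeeze_zero (fun n => Real.iSup_nonneg fun x => abs_nonneg _) (fun n => ?_) ht
  refine ciSup_le fun x => ?_
  rw [← Real.dist_eq]
  exact (dist_le_pi_dist _ _ x.2).trans (dist_le_pi_dist _ _ x.1)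
end

section
/- (Theorem 1, double-sided bounds) For any function Q : S → A → ℝ and all (s,a): r(s,a) + γ·( ∑_{s'} p(s,a)(s')·V_Q(s') + (min_{(s̄,ā)} Δ_Q(s̄,ā))/(1−γ) ) ≤ Q*(s,a) ≤ r(s,a) + γ·( ∑_{s'} p(s,a)(s')·V_Q(s') + (max_{(s̄,ā)} Δ_Q(s̄,ā))/(1−γ) ). -/
open Real

/-- The soft state-value function of `Q`. -/
noncomputable def softV {S A : Type*} [Fintype A]
    (β : ℝ) (π0 : S → PMF A) (Q : S → A → ℝ) (s : S) : ℝ :=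
  (1 / β) * Real.log (∑ a : A, (π0 s a).toReal * Real.exp (β * Q s a))

/-- The soft Bellman residual of `Q`. -/
noncomputable def softDelta {S A : Type*} [Fintype S] [Fintype A]
    (p : S → A → PMF S) (r : S → A → ℝ) (γ β : ℝ) (π0 : S → PMF A)
    (Q : S → A → ℝ) (s : S) (a : A) : ℝ :=
  r s a + γ * ∑ s' : S, (p s a s').toReal * softV β π0 Q s' - Q s a

theorem softV_le_add {S A : Type*} [Fintype A] [Nonempty A] (β : ℝ) (π0 : S → PMF A)
    (hβ : 0 < β) (hπ0 : ∀ s a, 0 < π0 s a) (Q1 Q2 : S → A → ℝ) (c : ℝ)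
    (h : ∀ s a, Q1 s a ≤ Q2 s a + c) (s : S) :
    softV β π0 Q1 s ≤ softV β π0 Q2 s + c := by
  have hw : ∀ a, 0 < (π0 s a).toReal := fun a =>
    ENNReal.toReal_pos (hπ0 s a).ne' ((π0 s).apply_ne_top a)
  have hpos : ∀ Q : S → A → ℝ, 0 < ∑ a : A, (π0 s a).toReal * Real.exp (β * Q s a) := fun Q =>
    Finset.sum_pos (fun a _ => mul_pos (hw a) (Real.exp_pos _)) Finset.univ_nonempty
  have h1 : (∑ a : A, (π0 s a).toReal * Real.exp (β * Q1 s a)) ≤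
      (∑ a : A, (π0 s a).toReal * Real.exp (β * Q2 s a)) * Real.exp (β * c) := by
    rw [Finset.sum_mul]
    refine Finset.sum_le_sum fun a _ => ?_
    rw [mul_assoc, ← Real.exp_add, ← mul_add]
    exact mul_le_mul_of_nonneg_left
      (Real.exp_le_exp.2 (mul_le_mul_of_nonneg_left (h s a) hβ.le)) (hw a).le
  have h2 := Real.log_le_log (hpos Q1) h1
  rw [Real.log_mul (hpos Q2).ne' (Real.exp_pos _).ne', Real.log_exp] at h2
  unfold softV
  have h3 := mul_le_mul_of_nonneg_left h2 (one_div_pos.2 hβ).le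
  have h4 : (1 / β) * (β * c) = c := by field_simp
  rw [mul_add, h4] at h3
  exact h3

theorem pmf_sum_le {S : Type*} [Fintype S] (q : PMF S) (f g : S → ℝ) (c : ℝ)
    (h : ∀ s, f s ≤ g s + c) :
    ∑ s, (q s).toReal * f s ≤ (∑ s, (q s).toReal * g s) + c := by
  have h1 : ∑ s, (q s).toReal = 1 := by
    rw [← ENNReal.toReal_sum (fun a _ => q.apply_ne_top a), ← tsum_fintype (L := .unconditional S), q.tsum_coe]
    rfl
  calc ∑ s, (q s).toReal * f s ≤ ∑ s, (q s).toReal * (g s + c) :=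
        Finset.sum_le_sum fun s _ => mul_le_mul_of_nonneg_left (h s) ENNReal.toReal_nonneg
    _ = _ := by simp_rw [mul_add]; rw [Finset.sum_add_distrib, ← Finset.sum_mul, h1, one_mul]

/-- Theorem 1 (double-sided bounds): for any function `Q` and all `(s,a)`,
`r(s,a) + γ·(E_{s'} V_Q(s') + (min Δ_Q)/(1−γ)) ≤ Q*(s,a)
  ≤ r(s,a) + γ·(E_{s'} V_Q(s') + (max Δ_Q)/(1−γ))`. -/
theorem double_sided_bounds
    {S A : Type*} [Fintype S] [Fintype A] [Nonempty S] [Nonempty A]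
    (p : S → A → PMF S) (r : S → A → ℝ) (γ β : ℝ) (π0 : S → PMF A)
    (hγ0 : 0 ≤ γ) (hγ1 : γ < 1) (hβ : 0 < β)
    (hπ0 : ∀ s a, 0 < π0 s a)
    (Qstar : S → A → ℝ) (hfix : softBellman p r γ β π0 Qstar = Qstar)
    (Q : S → A → ℝ) :
    ∀ s a,
      r s a + γ * ((∑ s' : S, (p s a s').toReal * softV β π0 Q s') +
          (⨅ x : S × A, softDelta p r γ β π0 Q x.1 x.2) / (1 - γ)) ≤ Qstar s a ∧
      Qstar s a ≤
        r s a + γ * ((∑ s' : S, (p s a s').toReal * softV β π0 Q s') +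
          (⨆ x : S × A, softDelta p r γ β π0 Q x.1 x.2) / (1 - γ)) := by
  have hQ : ∀ s a, Qstar s a = r s a + γ * ∑ s' : S, (p s a s').toReal * softV β π0 Qstar s' := by
    intro s a
    conv_lhs => rw [← hfix]
    simp only [softBellman, softV, Finset.mul_sum]
    congr 1
    refine Finset.sum_congr rfl fun _ _ => ?_
    ring
  have hE : ∀ (Q1 Q2 : S → A → ℝ) (c : ℝ), (∀ s a, Q1 s a ≤ Q2 s a + c) → ∀ s a,
      γ * ∑ s' : S, (p s a s').toReal * softV β π0 Q1 s' ≤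
      γ * ((∑ s' : S, (p s a s').toReal * softV β π0 Q2 s') + c) := fun Q1 Q2 c h s a =>
    mul_le_mul_of_nonneg_left
      (pmf_sum_le _ _ _ c (softV_le_add β π0 hβ hπ0 Q1 Q2 c h)) hγ0
  have hγ : 0 < 1 - γ := by linarith
  intro s a
  constructor
  · obtain ⟨x, hx⟩ := Finite.exists_max (fun x : S × A => Q x.1 x.2 - Qstar x.1 x.2)
    set M := Q x.1 x.2 - Qstar x.1 x.2 with hM
    have hle : ∀ s a, Q s a ≤ Qstar s a + M := fun s a => by
      have := hx (s, a)
      dsimp only at this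
      linarith
    have hi : (⨅ x : S × A, softDelta p r γ β π0 Q x.1 x.2) ≤ softDelta p r γ β π0 Q x.1 x.2 :=
      ciInf_le (Set.finite_range _).bddBelow x
    set I := ⨅ x : S × A, softDelta p r γ β π0 Q x.1 x.2
    have e1 := hE _ _ M hle x.1 x.2
    have e2 := hQ x.1 x.2
    unfold softDelta at hi
    have e3 : I / (1 - γ) ≤ -M := by
      rw [div_le_iff₀ hγ]
      linarith
    have e4 := hE _ _ M hle s a
    have e5 := mul_le_mul_of_nonneg_left e3 hγ0
    rw [hQ s a]
    linarith
  · obtain ⟨x, hx⟩ := Finite.exists_max (fun x : S × A => Qstar x.1 x.2 - Q x.1 x.2)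
    set M := Qstar x.1 x.2 - Q x.1 x.2 with hM
    have hle : ∀ s a, Qstar s a ≤ Q s a + M := fun s a => by
      have := hx (s, a)
      dsimp only at this
      linarith
    have hi : softDelta p r γ β π0 Q x.1 x.2 ≤ (⨆ x : S × A, softDelta p r γ β π0 Q x.1 x.2) :=
      le_ciSup (f := fun x : S × A => softDelta p r γ β π0 Q x.1 x.2)
        (Set.finite_range _).bddAbove x
    set I := ⨆ x : S × A, softDelta p r γ β π0 Q x.1 x.2
    have e1 := hE _ _ M hle x.1 x.2
    have e2 := hQ x.1 x.2
    unfold softDelta at hi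
    have e3 : M ≤ I / (1 - γ) := by
      rw [le_div_iff₀ hγ]
      linarith
    have e4 := hE _ _ M hle s a
    have e5 := mul_le_mul_of_nonneg_left e3 hγ0
    rw [hQ s a]
    linarith
end

section
/- (Exact transfer identity used in the proof of Theorem 1) Let Q : S → A → ℝ be any function. Define the tilted policy π_f(s)(a) = π0(s)(a)·exp(β·Q(s,a)) / ∑_{a'} π0(s)(a')·exp(β·Q(s,a')), and let K* : S → A → ℝ be the unique fixed point of the soft Bellman operator for the MDP with the same p, γ, β, but with reward function Δ_Q and prior policy π_f. Then Q*(s,a) = Q(s,a) + K*(s,a) for all (s,a). -/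
open Real

/-- The soft (entropy-regularized) Bellman operator for a finite MDP with transition
kernel `p`, reward `rew`, discount `γ`, inverse temperature `β` and (weight-valued)
prior policy `π` (given as a probability vector over actions for each state). -/
noncomputable def softBellmanGen {S A : Type*} [Fintype S] [Fintype A]
    (p : S → A → PMF S) (rew : S → A → ℝ) (γ β : ℝ) (pol : S → A → ℝ)
    (Q : S → A → ℝ) : S → A → ℝ :=
  fun s a => rew s a + (γ / β) * ∑ s' : S, (p s a s').toReal *
      Real.log (∑ a' : A, pol s' a' * Real.exp (β * Q s' a'))

theorem soft_le {S A : Type*} [Fintype S] [Fintype A] [Nonempty S] [Nonempty A]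
    (p : S → A → PMF S) (r : S → A → ℝ) (γ β : ℝ) (w : S → A → ℝ)
    (hγ0 : 0 ≤ γ) (hγ1 : γ < 1) (hβ : 0 < β) (hw : ∀ s a, 0 < w s a)
    (F G : S → A → ℝ) (hF : softBellmanGen p r γ β w F = F)
    (hG : softBellmanGen p r γ β w G = G) : ∀ s a, F s a ≤ G s a := by
  obtain ⟨⟨s0, a0⟩, h0⟩ := Finite.exists_max (fun x : S × A => F x.1 x.2 - G x.1 x.2)
  set D := F s0 a0 - G s0 a0 with hD
  have hmax : ∀ s a, F s a - G s a ≤ D := fun s a => h0 (s, a)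
  have hlog : ∀ s, Real.log (∑ a, w s a * Real.exp (β * F s a)) ≤
      Real.log (∑ a, w s a * Real.exp (β * G s a)) + β * D := by
    intro s
    have p1 : ∀ H : S → A → ℝ, 0 < ∑ a, w s a * Real.exp (β * H s a) := fun H =>
      Finset.sum_pos (fun a _ => mul_pos (hw s a) (Real.exp_pos _)) Finset.univ_nonempty
    rw [← Real.log_exp (β * D), ← Real.log_mul (p1 G).ne' (Real.exp_pos _).ne']
    apply Real.log_le_log (p1 F)
    rw [Finset.sum_mul]
    apply Finset.sum_le_sum
    intro a _
    rw [mul_assoc, ← Real.exp_add]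
    apply mul_le_mul_of_nonneg_left _ (hw s a).le
    apply Real.exp_le_exp.mpr
    nlinarith [hmax s a]
  have hp : ∑ s', (p s0 a0 s').toReal = 1 := by
    rw [← ENNReal.toReal_sum (fun s _ => PMF.apply_ne_top _ _), ← tsum_fintype (L := .unconditional _), PMF.tsum_coe]
    simp
  have hsum : ∑ s', (p s0 a0 s').toReal * Real.log (∑ a, w s' a * Real.exp (β * F s' a)) ≤
      ∑ s', (p s0 a0 s').toReal * Real.log (∑ a, w s' a * Real.exp (β * G s' a)) + β * D := by
    calc _ ≤ ∑ s', (p s0 a0 s').toReal *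
          (Real.log (∑ a, w s' a * Real.exp (β * G s' a)) + β * D) :=
          Finset.sum_le_sum fun s _ => mul_le_mul_of_nonneg_left (hlog s) ENNReal.toReal_nonneg
      _ = _ := by
          simp only [mul_add, Finset.sum_add_distrib]
          rw [← Finset.sum_mul, hp, one_mul]
  have e1 := congrFun (congrFun hF s0) a0
  have e2 := congrFun (congrFun hG s0) a0
  simp only [softBellmanGen] at e1 e2
  have h3 := mul_le_mul_of_nonneg_left hsum (div_nonneg hγ0 hβ.le)
  have h4 : γ / β * (β * D) = γ * D := by field_simp
  rw [mul_add, h4] at h3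
  have h5 : D ≤ γ * D := by linarith
  have h6 : D ≤ 0 := by nlinarith
  intro s a
  linarith [hmax s a]

/-- Exact transfer identity: if `K*` is the optimal soft value function for the task
with reward `Δ_Q` and tilted prior policy `π_f ∝ π0·exp(β Q)`, then
`Q*(s,a) = Q(s,a) + K*(s,a)`. -/
theorem exact_transfer_identity
    {S A : Type*} [Fintype S] [Fintype A] [Nonempty S] [Nonempty A]
    (p : S → A → PMF S) (r : S → A → ℝ) (γ β : ℝ) (π0 : S → PMF A)
    (hγ0 : 0 ≤ γ) (hγ1 : γ < 1) (hβ : 0 < β)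
    (hπ0 : ∀ s a, 0 < π0 s a)
    (Qstar : S → A → ℝ)
    (hfixQ : softBellmanGen p r γ β (fun s a => (π0 s a).toReal) Qstar = Qstar)
    (Q : S → A → ℝ)
    (πf : S → A → ℝ)
    (hπf : ∀ s a, πf s a = (π0 s a).toReal * Real.exp (β * Q s a) /
        ∑ a' : A, (π0 s a').toReal * Real.exp (β * Q s a'))
    (Kstar : S → A → ℝ)
    (hfixK : softBellmanGen p (softDelta p r γ β π0 Q) γ β πf Kstar = Kstar) :
    ∀ s a, Qstar s a = Q s a + Kstar s a := by
  have hw : ∀ s a, 0 < (π0 s a).toReal := fun s a =>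
    ENNReal.toReal_pos (hπ0 s a).ne' (PMF.apply_ne_top _ _)
  have pos : ∀ (H : S → A → ℝ) s, 0 < ∑ a, (π0 s a).toReal * Real.exp (β * H s a) := fun H s =>
    Finset.sum_pos (fun a _ => mul_pos (hw s a) (Real.exp_pos _)) Finset.univ_nonempty
  have hG : softBellmanGen p r γ β (fun s a => (π0 s a).toReal)
      (fun s a => Q s a + Kstar s a) = fun s a => Q s a + Kstar s a := by
    funext s a
    have e := congrFun (congrFun hfixK s) a
    have hl : ∀ s', Real.log (∑ a', πf s' a' * Real.exp (β * Kstar s' a')) =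
        Real.log (∑ a', (π0 s' a').toReal * Real.exp (β * (Q s' a' + Kstar s' a'))) -
        Real.log (∑ a', (π0 s' a').toReal * Real.exp (β * Q s' a')) := by
      intro s'
      rw [← Real.log_div (pos (fun s a => Q s a + Kstar s a) s').ne' (pos Q s').ne',
        Finset.sum_div]
      congr 1
      apply Finset.sum_congr rfl
      intro a' _
      rw [hπf, mul_add, Real.exp_add]
      ring
    have hv : γ * ∑ s', (p s a s').toReal * softV β π0 Q s' =
        γ / β * ∑ s', (p s a s').toReal *
          Real.log (∑ a', (π0 s' a').toReal * Real.exp (β * Q s' a')) := by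
      simp only [softV, Finset.mul_sum]
      apply Finset.sum_congr rfl
      intro s' _
      ring
    simp only [softBellmanGen, softDelta, hl, hv, mul_sub, Finset.sum_sub_distrib] at e ⊢
    linarith
  intro s a
  exact le_antisymm (soft_le p r γ β _ hγ0 hγ1 hβ hw _ _ hfixQ hG s a)
    (soft_le p r γ β _ hγ0 hγ1 hβ hw _ _ hG hfixQ s a)
end

section
/- (Mellowmax is 1-Lipschitz in the sup norm) Let A be a finite nonempty type, β > 0, and let w : A → ℝ be probability weights with w(a) > 0 for all a and ∑_a w(a) = 1. Then for all f, g : A → ℝ: |(1/β)·log(∑_a w(a)·exp(β·f(a))) − (1/β)·log(∑_a w(a)·exp(β·g(a)))| ≤ max_a |f(a) − g(a)|. -/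
open Real

/-- Mellowmax (weighted log-sum-exp) is 1-Lipschitz in the sup norm: for strictly
positive probability weights `w` and `β > 0`,
`|(1/β)·log ∑ w(a)·exp(β f(a)) − (1/β)·log ∑ w(a)·exp(β g(a))| ≤ max_a |f(a) − g(a)|`. -/
theorem mellowmax_one_lipschitz {A : Type*} [Fintype A] [Nonempty A]
    (β : ℝ) (hβ : 0 < β) (w : A → ℝ)
    (hw : ∀ a, 0 < w a) (hsum : ∑ a : A, w a = 1)
    (f g : A → ℝ) :
    |(1 / β) * Real.log (∑ a : A, w a * Real.exp (β * f a)) -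
      (1 / β) * Real.log (∑ a : A, w a * Real.exp (β * g a))| ≤
      ⨆ a : A, |f a - g a| := by
  have hM : ∀ a, |f a - g a| ≤ ⨆ a : A, |f a - g a| := fun a =>
    le_ciSup (f := fun a => |f a - g a|) (Set.finite_range _).bddAbove a
  generalize (⨆ a : A, |f a - g a|) = M at hM ⊢
  have pos : ∀ u : A → ℝ, 0 < ∑ a : A, w a * Real.exp (β * u a) := fun u =>
    Finset.sum_pos (fun a _ => mul_pos (hw a) (Real.exp_pos _)) Finset.univ_nonempty
  have key : ∀ u v : A → ℝ, (∀ a, u a ≤ v a + M) →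
      (1 / β) * Real.log (∑ a : A, w a * Real.exp (β * u a)) ≤
      (1 / β) * Real.log (∑ a : A, w a * Real.exp (β * v a)) + M := by
    intro u v h
    have h1 : ∑ a : A, w a * Real.exp (β * u a) ≤
        (∑ a : A, w a * Real.exp (β * v a)) * Real.exp (β * M) := by
      rw [Finset.sum_mul]
      refine Finset.sum_le_sum fun a _ => ?_
      rw [mul_assoc, ← Real.exp_add, ← mul_add]
      exact mul_le_mul_of_nonneg_left
        (Real.exp_le_exp.2 (mul_le_mul_of_nonneg_left (h a) hβ.le)) (hw a).le
    have h2 := Real.log_le_log (pos u) h1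
    rw [Real.log_mul (pos v).ne' (Real.exp_pos _).ne', Real.log_exp] at h2
    have h3 := mul_le_mul_of_nonneg_left h2 (one_div_pos.2 hβ).le
    have h4 : 1 / β * (β * M) = M := by field_simp
    rw [mul_add, h4] at h3
    exact h3
  have k1 := key f g fun a => by linarith [(abs_le.1 (hM a)).2]
  have k2 := key g f fun a => by linarith [(abs_le.1 (hM a)).1]
  exact abs_le.2 ⟨by linarith, by linarith⟩
end

section
/- (Lipschitz constant of the soft state-value function, intermediate step of Lemma B) Let S be a metric space, A a finite nonempty type, β > 0, and let π0 : S → A → ℝ satisfy π0(s,a) > 0 and ∑_a π0(s,a) = 1 for every s. Suppose that for each a ∈ A the map s ↦ Q(s,a) is L_Q-Lipschitz and the map s ↦ log(π0(s,a)) is L_κ-Lipschitz. Then the soft state-value function V(s) = (1/β)·log(∑_a π0(s,a)·exp(β·Q(s,a))) is (L_Q + L_κ/β)-Lipschitz on S. -/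
open Real

/-- Lipschitz constant of the soft state-value function: if `s ↦ Q(s,a)` is
`L_Q`-Lipschitz and `s ↦ log π0(s,a)` is `L_κ`-Lipschitz for each action `a`, then the
soft state-value `V(s) = (1/β)·log ∑_a π0(s,a)·exp(β Q(s,a))` is
`(L_Q + L_κ/β)`-Lipschitz. -/
theorem softV_lipschitz {S : Type*} [MetricSpace S] {A : Type*} [Fintype A] [Nonempty A]
    (β : ℝ) (hβ : 0 < β)
    (π0 : S → A → ℝ) (hπpos : ∀ s a, 0 < π0 s a) (hπsum : ∀ s, ∑ a : A, π0 s a = 1)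
    (Q : S → A → ℝ) (LQ Lκ : ℝ)
    (hQ : ∀ (a : A) (s s' : S), |Q s a - Q s' a| ≤ LQ * dist s s')
    (hκ : ∀ (a : A) (s s' : S), |Real.log (π0 s a) - Real.log (π0 s' a)| ≤ Lκ * dist s s') :
    ∀ s s' : S,
      |(1 / β) * Real.log (∑ a : A, π0 s a * Real.exp (β * Q s a)) -
        (1 / β) * Real.log (∑ a : A, π0 s' a * Real.exp (β * Q s' a))| ≤
        (LQ + Lκ / β) * dist s s' := by
  have pos : ∀ s, 0 < ∑ a : A, π0 s a * Real.exp (β * Q s a) := fun s =>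
    Finset.sum_pos (fun a _ => mul_pos (hπpos s a) (Real.exp_pos _)) Finset.univ_nonempty
  have key : ∀ s s' : S, Real.log (∑ a : A, π0 s a * Real.exp (β * Q s a)) ≤
      (β * LQ + Lκ) * dist s s' + Real.log (∑ a : A, π0 s' a * Real.exp (β * Q s' a)) := by
    intro s s'
    rw [Real.log_le_iff_le_exp (pos s), Real.exp_add, Real.exp_log (pos s'), Finset.mul_sum]
    refine Finset.sum_le_sum fun a _ => ?_
    have h1 := (abs_le.mp (hQ a s s')).2
    have h2 := (abs_le.mp (hκ a s s')).2
    have h3 := mul_le_mul_of_nonneg_left h1 hβ.le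
    rw [← Real.exp_log (hπpos s a), ← Real.exp_log (hπpos s' a), ← Real.exp_add,
      ← Real.exp_add, ← Real.exp_add]
    apply Real.exp_le_exp.mpr
    linarith
  intro s s'
  have h1 := key s s'
  have h2 := key s' s
  rw [dist_comm s' s] at h2
  have e : (LQ + Lκ / β) * dist s s' = (1 / β) * ((β * LQ + Lκ) * dist s s') := by
    field_simp
  rw [← mul_sub, abs_mul, abs_of_pos (one_div_pos.mpr hβ), e]
  refine mul_le_mul_of_nonneg_left ?_ (one_div_pos.mpr hβ).le
  rw [abs_le]
  constructor <;> linarith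
end

section
/- (Lemma B) Let S be a metric space and A a finite metric space, and equip S × A with the metric d((s,a),(s',a')) = d_S(s,s') + d_A(a,a'). Let β > 0, 0 ≤ γ < 1, let p assign to each (s,a) ∈ S × A a Borel probability measure p(s,a) on S, let r : S × A → ℝ be L_r-Lipschitz, let Q : S × A → ℝ be bounded and L_Q-Lipschitz, and let π0 : S → A → ℝ be strictly positive probability vectors with s ↦ log(π0(s,a)) L_κ-Lipschitz for each a. Assume the kernel is L_p-Lipschitz in the sense that for every bounded L-Lipschitz function φ : S → ℝ and all (s,a), (s',a'): |∫ φ d p(s,a) − ∫ φ d p(s',a')| ≤ L_p·L·d((s,a),(s',a')). Define V_Q(s) = (1/β)·log(∑_a π0(s,a)·exp(β·Q(s,a))) and Δ(s,a) = r(s,a) + γ·∫ V_Q d p(s,a) − Q(s,a). Then Δ is Lipschitz on S × A with constant L_Δ = L_r + L_Q + γ·L_p·(L_Q + L_κ/β). -/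
open Real MeasureTheory

/-- Lemma B: Lipschitz constant of the soft Bellman residual `Δ`. With `L_r`-Lipschitz
rewards, `L_p`-Lipschitz dynamics, `L_κ`-Lipschitz log-prior and an `L_Q`-Lipschitz
bounded input function `Q`, the residual
`Δ(s,a) = r(s,a) + γ·∫ V_Q dp(s,a) − Q(s,a)` is Lipschitz on `S × A` (with the sum
metric) with constant `L_Δ = L_r + L_Q + γ·L_p·(L_Q + L_κ/β)`. -/
theorem delta_lipschitz
    {S : Type*} [MetricSpace S] [MeasurableSpace S] [BorelSpace S]
    {A : Type*} [Fintype A] [Nonempty A] [MetricSpace A]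
    (β γ : ℝ) (hβ : 0 < β) (hγ0 : 0 ≤ γ) (hγ1 : γ < 1)
    (p : S → A → Measure S) (hp : ∀ s a, IsProbabilityMeasure (p s a))
    (r : S → A → ℝ) (Lr : ℝ)
    (hr : ∀ (s : S) (a : A) (s' : S) (a' : A),
      |r s a - r s' a'| ≤ Lr * (dist s s' + dist a a'))
    (Q : S → A → ℝ) (LQ : ℝ) (hQbdd : ∃ C, ∀ s a, |Q s a| ≤ C)
    (hQ : ∀ (s : S) (a : A) (s' : S) (a' : A),
      |Q s a - Q s' a'| ≤ LQ * (dist s s' + dist a a'))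
    (π0 : S → A → ℝ) (hπpos : ∀ s a, 0 < π0 s a) (hπsum : ∀ s, ∑ a : A, π0 s a = 1)
    (Lκ : ℝ)
    (hκ : ∀ (a : A) (s s' : S), |Real.log (π0 s a) - Real.log (π0 s' a)| ≤ Lκ * dist s s')
    (Lp : ℝ)
    (hLp : ∀ (L : ℝ) (φ : S → ℝ), (∀ x y, |φ x - φ y| ≤ L * dist x y) →
      (∃ C, ∀ x, |φ x| ≤ C) →
      ∀ (s : S) (a : A) (s' : S) (a' : A),
        |(∫ x, φ x ∂(p s a)) - ∫ x, φ x ∂(p s' a')| ≤ Lp * L * (dist s s' + dist a a'))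
    (V : S → ℝ)
    (hV : ∀ s, V s = (1 / β) * Real.log (∑ a : A, π0 s a * Real.exp (β * Q s a)))
    (Δ : S → A → ℝ)
    (hΔ : ∀ s a, Δ s a = r s a + γ * (∫ s', V s' ∂(p s a)) - Q s a) :
    ∀ (s : S) (a : A) (s' : S) (a' : A),
      |Δ s a - Δ s' a'| ≤
        (Lr + LQ + γ * Lp * (LQ + Lκ / β)) * (dist s s' + dist a a') := by
  have hpos : ∀ s, 0 < ∑ a : A, π0 s a * Real.exp (β * Q s a) := fun s =>
    Finset.sum_pos (fun a _ => mul_pos (hπpos s a) (Real.exp_pos _)) Finset.univ_nonempty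
  have key : ∀ x y, V x - V y ≤ (LQ + Lκ / β) * dist x y := by
    intro x y
    have h1 : ∑ a : A, π0 x a * Real.exp (β * Q x a) ≤
        Real.exp ((β * LQ + Lκ) * dist x y) * ∑ a : A, π0 y a * Real.exp (β * Q y a) := by
      rw [Finset.mul_sum]
      refine Finset.sum_le_sum fun a _ => ?_
      rw [← Real.exp_log (hπpos x a), ← Real.exp_log (hπpos y a), ← Real.exp_add,
        ← Real.exp_add, ← Real.exp_add]
      apply Real.exp_le_exp.mpr
      have e1 := (abs_le.mp (hκ a x y)).2
      have e2 := (abs_le.mp (hQ x a y a)).2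
      rw [dist_self, add_zero] at e2
      have e3 := mul_le_mul_of_nonneg_left e2 hβ.le
      linarith
    have h2 := Real.log_le_log (hpos x) h1
    rw [Real.log_mul (Real.exp_pos _).ne' (hpos y).ne', Real.log_exp] at h2
    rw [hV, hV, ← mul_sub]
    have h3 : (LQ + Lκ / β) * dist x y = (1 / β) * ((β * LQ + Lκ) * dist x y) := by
      field_simp
    rw [h3]
    apply mul_le_mul_of_nonneg_left _ (by positivity)
    linarith
  have hLip : ∀ x y, |V x - V y| ≤ (LQ + Lκ / β) * dist x y := by
    intro x y
    refine abs_le.mpr ⟨?_, key x y⟩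
    have := key y x
    rw [dist_comm] at this
    linarith
  have hbdd : ∃ C, ∀ x, |V x| ≤ C := by
    obtain ⟨C, hC⟩ := hQbdd
    refine ⟨C, fun x => ?_⟩
    have hu : ∑ a : A, π0 x a * Real.exp (β * Q x a) ≤ Real.exp (β * C) := by
      calc _ ≤ ∑ a : A, π0 x a * Real.exp (β * C) := Finset.sum_le_sum fun a _ =>
            mul_le_mul_of_nonneg_left (Real.exp_le_exp.mpr
              (mul_le_mul_of_nonneg_left (abs_le.mp (hC x a)).2 hβ.le)) (hπpos x a).le
        _ = _ := by rw [← Finset.sum_mul, hπsum, one_mul]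
    have hl : Real.exp (β * (-C)) ≤ ∑ a : A, π0 x a * Real.exp (β * Q x a) := by
      calc _ = ∑ a : A, π0 x a * Real.exp (β * (-C)) := by
            rw [← Finset.sum_mul, hπsum, one_mul]
        _ ≤ _ := Finset.sum_le_sum fun a _ =>
            mul_le_mul_of_nonneg_left (Real.exp_le_exp.mpr
              (mul_le_mul_of_nonneg_left (abs_le.mp (hC x a)).1 hβ.le)) (hπpos x a).le
    have hu' := Real.log_le_log (hpos x) hu
    have hl' := Real.log_le_log (Real.exp_pos _) hl
    rw [Real.log_exp] at hu' hl'
    rw [hV, one_div_mul_eq_div]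
    refine abs_le.mpr ⟨?_, ?_⟩
    · rw [le_div_iff₀ hβ]; linarith
    · rw [div_le_iff₀ hβ]; linarith
  intro s a s' a'
  have h1 := abs_le.mp (hr s a s' a')
  have h2 := abs_le.mp (hQ s a s' a')
  have h3 := abs_le.mp (hLp _ V hLip hbdd s a s' a')
  have h4 := mul_le_mul_of_nonneg_left h3.1 hγ0
  have h5 := mul_le_mul_of_nonneg_left h3.2 hγ0
  rw [hΔ, hΔ]
  refine abs_le.mpr ⟨?_, ?_⟩ <;> linarith [h1.1, h1.2, h2.1, h2.2]
end

section
/- (Lemma E, action-sampling error of the soft state-value) Let π0 be a probability measure on a measurable space A, let R_min ≤ R_max be reals, 0 ≤ γ < 1, β > 0, and let Q : A → ℝ be measurable with R_min/(1−γ) ≤ Q(a) ≤ R_max/(1−γ) for all a. Define V = (1/β)·log ∫ exp(β·Q(a)) dπ0(a). Let 0 < ε < (R_max − R_min)/(1−γ), δ ∈ (0,1), and n ≥ (1/2)·((exp(β·(R_max − R_min)/(1−γ)) − 1)/(exp(β·ε) − 1))² · log(2/δ). If a_1, …, a_n are i.i.d. with law π0 and V̂ = (1/β)·log((1/n)·∑_{i=1}^n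 exp(β·Q(a_i))), then with probability at least 1 − δ: |V − V̂| ≤ ε. -/
open Real MeasureTheory


lemma hoeff_aux {A : Type*} [MeasurableSpace A] (π0 : Measure A) [IsProbabilityMeasure π0]
    (f : A → ℝ) (hf : Measurable f) (a b : ℝ) (hb : ∀ x, f x ∈ Set.Icc a b) (n : ℕ)
    (s : ℝ) (hs : 0 ≤ s) :
    (Measure.pi fun _ : Fin n => π0).real {ω | s ≤ ∑ i : Fin n, (f (ω i) - ∫ x, f x ∂π0)} ≤
      Real.exp (-s ^ 2 / (2 * (n * ((b - a) / 2) ^ 2))) := by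
  have hind : ProbabilityTheory.iIndepFun (fun (i : Fin n) (ω : Fin n → A) =>
      f (ω i) - ∫ x, f x ∂π0) (Measure.pi fun _ : Fin n => π0) :=
    ProbabilityTheory.iIndepFun_pi (X := fun (_ : Fin n) x => f x - ∫ x, f x ∂π0)
      (fun _ => (hf.sub_const _).aemeasurable)
  have hsub : ∀ i ∈ (Finset.univ : Finset (Fin n)), ProbabilityTheory.HasSubgaussianMGF
      (fun ω : Fin n → A => f (ω i) - ∫ x, f x ∂π0) ((‖b - a‖₊ / 2) ^ 2)
      (Measure.pi fun _ : Fin n => π0) := by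
    intro i _
    have := ProbabilityTheory.hasSubgaussianMGF_of_mem_Icc
      (μ := Measure.pi fun _ : Fin n => π0) (X := fun ω => f (ω i)) (a := a) (b := b)
      (hf.comp (measurable_pi_apply i)).aemeasurable (ae_of_all _ fun ω => hb _)
    rwa [integral_comp_eval (μ := fun _ : Fin n => π0) (i := i) hf.aestronglyMeasurable] at this
  have := ProbabilityTheory.HasSubgaussianMGF.measure_sum_ge_le_of_iIndepFun hind
    (c := fun _ => (‖b - a‖₊ / 2) ^ 2) hsub hs
  refine this.trans (le_of_eq ?_)
  simp [div_pow]

lemma log_aux (β ε L m x : ℝ) (hβ : 0 < β) (hL : 0 < L) (hm : L ≤ m) (hx : L ≤ x)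
    (hE : 1 ≤ Real.exp (β * ε))
    (h : m - x ≤ L * (Real.exp (β * ε) - 1)) :
    (1 / β) * Real.log m - (1 / β) * Real.log x ≤ ε := by
  have hx0 : 0 < x := hL.trans_le hx
  have h1 : m ≤ x * Real.exp (β * ε) := by nlinarith
  have h2 := Real.log_le_log (hL.trans_le hm) h1
  rw [Real.log_mul hx0.ne' (Real.exp_pos _).ne', Real.log_exp] at h2
  rw [← mul_sub, one_div, inv_mul_le_iff₀ hβ]
  linarith

/-- Lemma E: action-sampling error of the soft state-value. With
`V = (1/β)·log ∫ exp(β Q) dπ0` and `V̂ = (1/β)·log((1/n)∑ exp(β Q(a_i)))`, if `Q` takes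
values in `[R_min/(1−γ), R_max/(1−γ)]`, `0 < ε < (R_max−R_min)/(1−γ)` and
`n ≥ (1/2)·((exp(β(R_max−R_min)/(1−γ))−1)/(exp(βε)−1))²·log(2/δ)` actions are drawn
i.i.d. from `π0`, then with probability at least `1 − δ`, `|V − V̂| ≤ ε`. -/
theorem action_sampling_error
    {A : Type*} [MeasurableSpace A]
    (π0 : Measure A) [IsProbabilityMeasure π0]
    (Rmin Rmax γ β : ℝ) (hR : Rmin ≤ Rmax) (hγ0 : 0 ≤ γ) (hγ1 : γ < 1) (hβ : 0 < β)
    (Q : A → ℝ) (hQm : Measurable Q)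
    (hQb : ∀ a, Q a ∈ Set.Icc (Rmin / (1 - γ)) (Rmax / (1 - γ)))
    (ε δ : ℝ) (hε : 0 < ε) (hεlt : ε < (Rmax - Rmin) / (1 - γ))
    (hδ : δ ∈ Set.Ioo (0 : ℝ) 1)
    (n : ℕ)
    (hn : (1 / 2) *
        ((Real.exp (β * (Rmax - Rmin) / (1 - γ)) - 1) / (Real.exp (β * ε) - 1)) ^ 2 *
        Real.log (2 / δ) ≤ n) :
    (Measure.pi fun _ : Fin n => π0)
      {ω : Fin n → A |
        |(1 / β) * Real.log (∫ a, Real.exp (β * Q a) ∂π0) -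
          (1 / β) * Real.log ((1 / (n : ℝ)) * ∑ i : Fin n, Real.exp (β * Q (ω i)))| ≤ ε} ≥
      ENNReal.ofReal (1 - δ) := by
  obtain ⟨hδ0, hδ1⟩ := hδ
  have hg : 0 < 1 - γ := by linarith
  set L := Real.exp (β * (Rmin / (1 - γ))) with hLdef
  set U := Real.exp (β * (Rmax / (1 - γ))) with hUdef
  have hL : 0 < L := Real.exp_pos _
  set f : A → ℝ := fun a => Real.exp (β * Q a) with hfdef
  have hf : Measurable f := by fun_prop
  have hfb : ∀ a, f a ∈ Set.Icc L U := fun a =>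
    ⟨Real.exp_le_exp.2 (mul_le_mul_of_nonneg_left (hQb a).1 hβ.le),
      Real.exp_le_exp.2 (mul_le_mul_of_nonneg_left (hQb a).2 hβ.le)⟩
  have hfi : Integrable f π0 := Integrable.of_mem_Icc L U hf.aemeasurable (ae_of_all _ hfb)
  set m := ∫ a, f a ∂π0 with hmdef
  have hm : L ≤ m := by
    have := integral_mono (integrable_const L) hfi (fun a => (hfb a).1)
    simpa using this
  have hE : 1 < Real.exp (β * ε) := Real.one_lt_exp_iff.2 (by positivity)
  have hD : 1 < Real.exp (β * (Rmax - Rmin) / (1 - γ)) := by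
    apply Real.one_lt_exp_iff.2
    rw [mul_div_assoc]
    exact mul_pos hβ (hε.trans hεlt)
  set K := (Real.exp (β * (Rmax - Rmin) / (1 - γ)) - 1) / (Real.exp (β * ε) - 1) with hK
  have hK0 : 0 < K := div_pos (by linarith) (by linarith)
  set t := L * (Real.exp (β * ε) - 1) with ht
  have ht0 : 0 < t := mul_pos hL (by linarith)
  have hUL : U - L = t * K := by
    have h1 : U = L * Real.exp (β * (Rmax - Rmin) / (1 - γ)) := by
      rw [hLdef, hUdef, ← Real.exp_add]; congr 1; ring
    have h2 : Real.exp (β * ε) - 1 ≠ 0 := by linarith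
    rw [h1, ht, hK]; field_simp
  have hlog : 0 < Real.log (2 / δ) := Real.log_pos (by rw [lt_div_iff₀ hδ0]; linarith)
  have hn0 : (0 : ℝ) < n := lt_of_lt_of_le (by positivity) hn
  have hexp : Real.exp (-(n * t) ^ 2 / (2 * (n * ((t * K) / 2) ^ 2))) ≤ δ / 2 := by
    have h1 : -(n * t) ^ 2 / (2 * (n * ((t * K) / 2) ^ 2)) = -(2 * n / K ^ 2) := by
      field_simp
    have h2 : Real.log (2 / δ) ≤ 2 * n / K ^ 2 := by
      rw [le_div_iff₀ (by positivity)]; linarith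
    rw [h1]
    calc Real.exp (-(2 * n / K ^ 2)) ≤ Real.exp (-Real.log (2 / δ)) :=
          Real.exp_le_exp.2 (neg_le_neg h2)
      _ = δ / 2 := by rw [Real.exp_neg, Real.exp_log (by positivity), inv_div]
  have B1 := (hoeff_aux π0 f hf L U hfb n (n * t) (by positivity)).trans
    (c := δ / 2) (by rw [hUL]; exact hexp)
  have B2 := (hoeff_aux π0 (fun a => -f a) hf.neg (-U) (-L)
    (fun a => ⟨neg_le_neg (hfb a).2, neg_le_neg (hfb a).1⟩) n (n * t) (by positivity)).trans
    (c := δ / 2) (by rw [show -L - -U = U - L by ring, hUL]; exact hexp)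
  rw [integral_neg] at B2
  set P := Measure.pi fun _ : Fin n => π0 with hP
  set S := {ω : Fin n → A |
        |(1 / β) * Real.log m -
          (1 / β) * Real.log ((1 / (n : ℝ)) * ∑ i : Fin n, f (ω i))| ≤ ε} with hS
  change P S ≥ ENNReal.ofReal (1 - δ)
  set S1 := {ω : Fin n → A | n * t ≤ ∑ i : Fin n, (f (ω i) - ∫ x, f x ∂π0)} with hS1
  set S2 := {ω : Fin n → A | n * t ≤ ∑ i : Fin n, (-f (ω i) - -∫ x, f x ∂π0)} with hS2
  have hsub : Sᶜ ⊆ S1 ∪ S2 := by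
    intro ω hω
    by_contra hc
    apply hω
    simp only [Set.mem_union, not_or, hS1, hS2, Set.mem_ofPred_eq, not_le,
      Finset.sum_sub_distrib, Finset.sum_neg_distrib, Finset.sum_const, Finset.card_univ,
      Fintype.card_fin, nsmul_eq_mul] at hc
    obtain ⟨c1, c2⟩ := hc
    rw [← hmdef] at c1 c2
    set T := ∑ i : Fin n, f (ω i) with hT
    have hTL : n * L ≤ T := by
      have := Finset.sum_le_sum (s := Finset.univ) (fun (i : Fin n) _ => (hfb (ω i)).1)
      simpa using this
    have hTx : T = n * ((1 / (n : ℝ)) * T) := by field_simp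
    set x := (1 / (n : ℝ)) * T with hx
    rw [hTx] at c1 c2 hTL
    have hxL : L ≤ x := le_of_mul_le_mul_left hTL hn0
    have d1 : x - m ≤ t := by
      refine le_of_mul_le_mul_left ?_ hn0
      linarith
    have d2 : m - x ≤ t := by
      refine le_of_mul_le_mul_left ?_ hn0
      linarith
    change |(1 / β) * Real.log m - (1 / β) * Real.log x| ≤ ε
    rw [abs_le]
    have e1 := log_aux β ε L m x hβ hL hm hxL hE.le d2
    have e2 := log_aux β ε L x m hβ hL hxL hm hE.le d1
    constructor <;> linarith
  have h1 : P.real Sᶜ ≤ δ := by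
    have a1 := measureReal_mono (μ := P) hsub
    have a2 := measureReal_union_le (μ := P) S1 S2
    linarith
  have h2 : (1 : ENNReal) ≤ P S + P Sᶜ := by
    have := measure_univ_le_add_compl (μ := P) S
    rwa [measure_univ] at this
  have h3 : P Sᶜ ≤ ENNReal.ofReal δ := by
    rw [← ofReal_measureReal]
    exact ENNReal.ofReal_le_ofReal h1
  rw [ge_iff_le, ENNReal.ofReal_sub _ hδ0.le, ENNReal.ofReal_one, tsub_le_iff_right]
  exact h2.trans (by gcongr)
end
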